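/- arXiv:2001.01700 — 3 statements merged into one kernel-verified Lean document; each statement's English description precedes it below -/
import Mathlib

section
/- Let ν be a probability measure on ℝ^D and let T_0, T_1 : ℝ^D → ℝ^D be measurable maps with ∫ ‖T_0(x)‖² dν(x) < ∞ and ∫ ‖T_1(x)‖² dν(x) < ∞. For s ∈ [0,1] let f_s := (1−s)·T_0 + s·T_1 and let M(s) be the D×D matrix with entries M(s)_{jk} := ∫ (f_s(x))_j (f_s(x))_k dν(x). Then the function s ↦ ‖M(s)‖_op (the largest eigenvalue of the positive semidefinite matrix M(s)) is convex on [0,1]. -/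
open Matrix MeasureTheory

/-- Euclidean space `ℝ^D`. -/
abbrev E (D : ℕ) := EuclideanSpace ℝ (Fin D)

/-- The `ℓ²→ℓ²` operator norm of a matrix; for a positive semidefinite matrix this is its
largest eigenvalue. -/
noncomputable def opNorm {D : ℕ} (A : Matrix (Fin D) (Fin D) ℝ) : ℝ :=
  ‖LinearMap.toContinuousLinearMap (Matrix.toEuclideanLin A)‖

theorem inner_toEuclideanLin_self_le_opNorm {D : ℕ} (A : Matrix (Fin D) (Fin D) ℝ) (v : E D) :
    inner ℝ (toEuclideanLin A v) v ≤ opNorm A * ‖v‖ ^ 2 := by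
  have h := (LinearMap.toContinuousLinearMap (toEuclideanLin A)).le_opNorm v
  calc inner ℝ (toEuclideanLin A v) v
      ≤ ‖toEuclideanLin A v‖ * ‖v‖ := real_inner_le_norm _ _
    _ ≤ (opNorm A * ‖v‖) * ‖v‖ := by
        gcongr
        exact h
    _ = opNorm A * ‖v‖ ^ 2 := by ring

theorem opNorm_le_of_forall_abs_inner_le {D : ℕ} {A : Matrix (Fin D) (Fin D) ℝ}
    (hA : A.IsHermitian) {C : ℝ} (hC : 0 ≤ C)
    (h : ∀ v : E D, |inner ℝ (toEuclideanLin A v) v| ≤ C * ‖v‖ ^ 2) : opNorm A ≤ C := by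
  have hsymm : (LinearMap.toContinuousLinearMap (toEuclideanLin A)).IsSymmetric :=
    isSymmetric_toEuclideanLin_iff.mpr hA
  rw [opNorm, ContinuousLinearMap.norm_eq_iSup_rayleighQuotient _ hsymm]
  refine ciSup_le fun v => ?_
  rw [ContinuousLinearMap.rayleighQuotient, abs_div, abs_of_nonneg (sq_nonneg ‖v‖)]
  exact div_le_of_le_mul₀ (sq_nonneg _) hC (h v)

theorem memLp_coord {α : Type*} [MeasurableSpace α] {μ : Measure α} {D : ℕ} {f : α → E D}
    (hf : MemLp f 2 μ) (j : Fin D) : MemLp (fun x => f x j) 2 μ :=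
  (EuclideanSpace.proj (𝕜 := ℝ) j).comp_memLp' hf

theorem inner_toEuclideanLin_second_moment {α : Type*} [MeasurableSpace α] {μ : Measure α}
    {D : ℕ} {f : α → E D} (hf : MemLp f 2 μ) {A : Matrix (Fin D) (Fin D) ℝ}
    (hA : ∀ j k, A j k = ∫ x, f x j * f x k ∂μ) (v : E D) :
    inner ℝ (toEuclideanLin A v) v = ∫ x, (inner ℝ (f x) v) ^ 2 ∂μ := by
  have hint (j k : Fin D) : Integrable (fun x => v j * v k * (f x j * f x k)) μ :=
    ((memLp_coord hf j).integrable_mul (memLp_coord hf k)).const_mul _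
  have hexp (x : α) : (inner ℝ (f x) v) ^ 2 = ∑ j, ∑ k, v j * v k * (f x j * f x k) := by
    simp only [PiLp.inner_apply, RCLike.inner_apply, conj_trivial, sq, Finset.sum_mul_sum]
    refine Finset.sum_congr rfl fun j _ => Finset.sum_congr rfl fun k _ => ?_
    ring
  simp_rw [hexp]
  rw [integral_finsetSum _ fun j _ => integrable_finsetSum _ fun k _ => hint j k]
  simp_rw [integral_finsetSum _ fun k _ => hint _ k, integral_const_mul, ← hA]
  simp only [PiLp.inner_apply, RCLike.inner_apply, conj_trivial, ofLp_toLpLin, toLin'_apply,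
    mulVec, dotProduct, Finset.mul_sum]
  refine Finset.sum_congr rfl fun j _ => Finset.sum_congr rfl fun k _ => ?_
  ring

/-- generalized-geodesic convexity of `μ ↦ ‖∫ x xᵀ dμ‖_op`: for measurable,
square-integrable maps `T_0, T_1` and `f_s = (1−s)T_0 + sT_1`, the function
`s ↦ ‖M(s)‖_op` with `M(s)_{jk} = ∫ (f_s x)_j (f_s x)_k dν(x)` is convex on `[0,1]`. -/
theorem opNorm_second_moment_convex {D : ℕ} (hD : 1 ≤ D)
    (ν : Measure (E D)) (hν : IsProbabilityMeasure ν)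
    (T0 T1 : E D → E D) (hT0 : Measurable T0) (hT1 : Measurable T1)
    (hi0 : Integrable (fun x => ‖T0 x‖ ^ 2) ν) (hi1 : Integrable (fun x => ‖T1 x‖ ^ 2) ν)
    (M : ℝ → Matrix (Fin D) (Fin D) ℝ)
    (hM : ∀ s j k, M s j k =
      ∫ x, ((1 - s) • T0 x + s • T1 x) j * ((1 - s) • T0 x + s • T1 x) k ∂ν) :
    ConvexOn ℝ (Set.Icc (0 : ℝ) 1) (fun s => opNorm (M s)) := by
  have hm0 := (memLp_two_iff_integrable_sq_norm hT0.aestronglyMeasurable).mpr hi0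
  have hm1 := (memLp_two_iff_integrable_sq_norm hT1.aestronglyMeasurable).mpr hi1
  have hf (s : ℝ) : MemLp (fun x => (1 - s) • T0 x + s • T1 x) 2 ν :=
    (hm0.const_smul (1 - s)).add (hm1.const_smul s)
  have hinner (s : ℝ) (v : E D) := inner_toEuclideanLin_second_moment (hf s) (hM s) v
  have hint (s : ℝ) (v : E D) :
      Integrable (fun x => (inner ℝ ((1 - s) • T0 x + s • T1 x) v) ^ 2) ν :=
    ((hf s).inner_const v).integrable_sq
  have hherm (s : ℝ) : (M s).IsHermitian := by
    ext j k
    simp only [conjTranspose_apply, star_trivial, hM, mul_comm]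
  refine ⟨convex_Icc 0 1, fun s _ t _ a b ha hb hab => ?_⟩
  have hnorm (r : ℝ) : 0 ≤ opNorm (M r) := norm_nonneg _
  simp only [smul_eq_mul]
  refine opNorm_le_of_forall_abs_inner_le (hherm _)
    (add_nonneg (mul_nonneg ha (hnorm s)) (mul_nonneg hb (hnorm t))) fun v => ?_
  rw [hinner, abs_of_nonneg (integral_nonneg fun x => sq_nonneg _)]
  have hs := inner_toEuclideanLin_self_le_opNorm (M s) v
  have ht := inner_toEuclideanLin_self_le_opNorm (M t) v
  rw [hinner] at hs ht
  have hconv : ∫ x, (inner ℝ ((1 - (a * s + b * t)) • T0 x + (a * s + b * t) • T1 x) v) ^ 2 ∂ν ≤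
      a * ∫ x, (inner ℝ ((1 - s) • T0 x + s • T1 x) v) ^ 2 ∂ν +
        b * ∫ x, (inner ℝ ((1 - t) • T0 x + t • T1 x) v) ^ 2 ∂ν := by
    rw [← integral_const_mul, ← integral_const_mul,
      ← integral_add ((hint s v).const_mul a) ((hint t v).const_mul b)]
    refine integral_mono (hint _ v) (((hint s v).const_mul a).add ((hint t v).const_mul b))
      fun x => ?_
    have hsq := (even_two.convexOn_pow (𝕜 := ℝ)).2
      (Set.mem_univ (inner ℝ ((1 - s) • T0 x + s • T1 x) v))
      (Set.mem_univ (inner ℝ ((1 - t) • T0 x + t • T1 x) v)) ha hb hab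
    simp only [smul_eq_mul] at hsq
    refine le_trans (le_of_eq ?_) hsq
    simp only [inner_add_left, real_inner_smul_left]
    obtain rfl : b = 1 - a := by linarith
    ring
  nlinarith [mul_le_mul_of_nonneg_left hs ha, mul_le_mul_of_nonneg_left ht hb]
end

section
/- Let C ∈ (0,1], V ≥ 0, and k ≥ 0 with C²(k+1)² ≥ 2k+1. Let n ≥ 1 and let a_0, a_1, …, a_n be nonnegative real numbers satisfying a_{t+1} ≤ ((t+k)/(t+k+1))² · a_t + 2V/(C²·(t+k+1)²) for every t ∈ {0, …, n−1}. Then a_n ≤ k²·a_0/(n+k)² + 2V/(C²·(n+k)); in particular, if a_0 ≤ V/2 and k = 2/C² − 1, then a_n ≤ 3V/(C²·n). -/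
/-- Unrolled form of the recursion: `(t + k)² a_t` grows by at most `B` per step. -/
theorem sq_mul_le_of_recursion {k B : ℝ} (hk : 0 ≤ k) {n : ℕ} {a : ℕ → ℝ}
    (hrec : ∀ t < n, a (t + 1) ≤
      (((t : ℝ) + k) / ((t : ℝ) + k + 1)) ^ 2 * a t + B / ((t : ℝ) + k + 1) ^ 2) :
    ∀ t ≤ n, ((t : ℝ) + k) ^ 2 * a t ≤ k ^ 2 * a 0 + t * B := by
  intro t
  induction t with
  | zero => simp
  | succ t ih =>
    intro ht
    have hpos : 0 < (t : ℝ) + k + 1 := by positivity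
    have hstep := hrec t ht
    rw [div_pow, div_mul_eq_mul_div, ← add_div, le_div_iff₀ (by positivity)] at hstep
    push_cast
    linarith [ih (by omega)]

/-- the real-sequence recursion underlying the SGD convergence analysis
under a PL inequality with constant `C`, variance `V` and step sizes
`η_t ≤ 2/(C(t+k+1))`. -/
theorem sgd_recursion_bound (C V k : ℝ) (hC : C ∈ Set.Ioc (0 : ℝ) 1) (hV : 0 ≤ V)
    (hk : 0 ≤ k) (hCk : 2 * k + 1 ≤ C ^ 2 * (k + 1) ^ 2)
    (n : ℕ) (hn : 1 ≤ n) (a : ℕ → ℝ) (ha : ∀ t, 0 ≤ a t)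
    (hrec : ∀ t < n, a (t + 1) ≤
      (((t : ℝ) + k) / ((t : ℝ) + k + 1)) ^ 2 * a t + 2 * V / (C ^ 2 * ((t : ℝ) + k + 1) ^ 2)) :
    a n ≤ k ^ 2 * a 0 / ((n : ℝ) + k) ^ 2 + 2 * V / (C ^ 2 * ((n : ℝ) + k)) ∧
    (a 0 ≤ V / 2 → k = 2 / C ^ 2 - 1 → a n ≤ 3 * V / (C ^ 2 * n)) := by
  have hC0 : 0 < C := hC.1
  have hn0 : (0 : ℝ) < n := by exact_mod_cast hn
  have hnk : 0 < (n : ℝ) + k := by positivity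
  have hbound : ((n : ℝ) + k) ^ 2 * a n ≤ k ^ 2 * a 0 + n * (2 * V / C ^ 2) :=
    sq_mul_le_of_recursion hk (fun t ht => by rw [div_div]; exact hrec t ht) n le_rfl
  constructor
  · have hB : 0 ≤ 2 * V / C ^ 2 := by positivity
    have hsplit : k ^ 2 * a 0 / ((n : ℝ) + k) ^ 2 + 2 * V / (C ^ 2 * ((n : ℝ) + k)) =
        (k ^ 2 * a 0 + (n + k) * (2 * V / C ^ 2)) / ((n : ℝ) + k) ^ 2 := by
      field_simp
    rw [hsplit, le_div_iff₀ (by positivity)]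
    nlinarith [mul_nonneg hk hB]
  · intro h0 hkC
    have hCinv : 2 / C ^ 2 = k + 1 := by linarith
    have hB : 2 * V / C ^ 2 = (k + 1) * V := by rw [← hCinv]; ring
    have htarget : 3 * V / (C ^ 2 * n) = 3 / 2 * ((k + 1) * V) / n := by
      rw [← hB]; field_simp
    rw [hB] at hbound
    rw [htarget, le_div_iff₀ hn0]
    have h0' : k ^ 2 * a 0 ≤ k ^ 2 * (V / 2) := by gcongr
    have hscaled : ((n : ℝ) + k) ^ 2 * (a n * n) ≤
        (k ^ 2 * (V / 2) + n * ((k + 1) * V)) * n := by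
      nlinarith
    have hcompare : (k ^ 2 * (V / 2) + n * ((k + 1) * V)) * n ≤
        ((n : ℝ) + k) ^ 2 * (3 / 2 * ((k + 1) * V)) := by
      have hrest : 0 ≤ V * (n ^ 2 * (k + 1) / 2 + 5 / 2 * k ^ 2 * n + 3 * k * n
          + 3 / 2 * (k + 1) * k ^ 2) := by positivity
      linarith
    exact le_of_mul_le_mul_left (hscaled.trans hcompare) (by positivity)
end

section
/- Let b_0 and b_1 be Borel probability measures on ℝ^D, let π be a coupling of b_0 and b_1 with ∫ ‖x−y‖² dπ(x,y) < ∞, and for s ∈ [0,1] let b_s denote the pushforward of π under the map (x,y) ↦ (1−s)x + sy. Let f : ℝ^D → ℝ be continuously differentiable with f integrable with respect to both b_0 and b_1. Then |∫ f db_0 − ∫ f db_1| ≤ (∫ ‖x−y‖² dπ(x,y))^{1/2} · ∫_0^1 (∫ ‖∇f(z)‖² db_s(z))^{1/2} ds, where the right-hand side is interpreted as +∞ if any of the integrals there diverge. -/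
open MeasureTheory

/-- `π` is a coupling of the probability measures `μ` and `ν`. -/
def IsCoupling {D : ℕ} (π : Measure (E D × E D)) (μ ν : Measure (E D)) : Prop :=
  IsProbabilityMeasure π ∧ π.map Prod.fst = μ ∧ π.map Prod.snd = ν

/-- The increment of a `C¹` function is bounded by the integral of its gradient along a segment. -/
theorem enorm_sub_le_lintegral_gradient {F : Type*} [NormedAddCommGroup F] [InnerProductSpace ℝ F]
    [CompleteSpace F] {f : F → ℝ} (hf : ContDiff ℝ 1 f) (x y : F) :
    ‖f x - f y‖ₑ ≤
      ∫⁻ s in Set.Icc (0 : ℝ) 1, ‖x - y‖ₑ * ‖gradient f ((1 - s) • x + s • y)‖ₑ := by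
  have hline (s : ℝ) : HasDerivAt (fun s : ℝ => (1 - s) • x + s • y) (y - x) s := by
    have h := (((hasDerivAt_id s).const_sub 1).smul_const x).add
      ((hasDerivAt_id s).smul_const y)
    exact h.congr_deriv (by rw [neg_one_smul, one_smul, neg_add_eq_sub])
  have hderiv (s : ℝ) : HasDerivAt (fun s : ℝ => f ((1 - s) • x + s • y))
      (fderiv ℝ f ((1 - s) • x + s • y) (y - x)) s :=
    ((hf.differentiable one_ne_zero _).hasFDerivAt).comp_hasDerivAt s (hline s)
  have hcont : Continuous fun s : ℝ => fderiv ℝ f ((1 - s) • x + s • y) (y - x) :=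
    ((hf.continuous_fderiv one_ne_zero).comp (by fun_prop)).clm_apply continuous_const
  have hftc := intervalIntegral.integral_eq_sub_of_hasDerivAt (a := 0) (b := 1)
    (fun s _ => hderiv s) (hcont.intervalIntegrable 0 1)
  simp only [sub_self, zero_smul, one_smul, zero_add, sub_zero, add_zero] at hftc
  rw [← enorm_neg, neg_sub, ← hftc, intervalIntegral.integral_of_le zero_le_one,
    ← integral_Icc_eq_integral_Ioc]
  refine (enorm_integral_le_lintegral_enorm _).trans (lintegral_mono fun s => ?_)
  have hgrad : ‖gradient f ((1 - s) • x + s • y)‖ₑ = ‖fderiv ℝ f ((1 - s) • x + s • y)‖ₑ := by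
    rw [← ofReal_norm, ← ofReal_norm, gradient, LinearIsometryEquiv.norm_map]
  rw [hgrad, mul_comm, ← enorm_neg (x - y), neg_sub]
  exact ContinuousLinearMap.le_opENorm _ _

theorem ContDiff.continuous_gradient {F : Type*} [NormedAddCommGroup F] [InnerProductSpace ℝ F]
    [CompleteSpace F] {f : F → ℝ} (hf : ContDiff ℝ 1 f) : Continuous (gradient f) :=
  (InnerProductSpace.toDual ℝ F).symm.continuous.comp (hf.continuous_fderiv one_ne_zero)

/-- along the displacement interpolation `b_s` induced by a coupling `π` of
`b_0` and `b_1` with finite quadratic cost, for every `C¹` function `f` integrable w.r.t.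
`b_0` and `b_1`:
`|∫ f db_0 − ∫ f db_1| ≤ (∫‖x−y‖² dπ)^{1/2} ∫_0^1 (∫‖∇f‖² db_s)^{1/2} ds`
(the right-hand side being `+∞` if any integral there diverges). -/
theorem displacement_interpolation_gradient_bound {D : ℕ} (hD : 1 ≤ D)
    (b0 b1 : Measure (E D)) (hb0 : IsProbabilityMeasure b0) (hb1 : IsProbabilityMeasure b1)
    (π : Measure (E D × E D)) (hπ : IsCoupling π b0 b1)
    (hfin : (∫⁻ p, (‖p.1 - p.2‖₊ : ENNReal) ^ 2 ∂π) < ⊤)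
    (f : E D → ℝ) (hf : ContDiff ℝ 1 f)
    (hf0 : Integrable f b0) (hf1 : Integrable f b1) :
    ENNReal.ofReal |(∫ x, f x ∂b0) - ∫ x, f x ∂b1| ≤
      (∫⁻ p, (‖p.1 - p.2‖₊ : ENNReal) ^ 2 ∂π) ^ (1 / 2 : ℝ) *
        ∫⁻ s in Set.Icc (0 : ℝ) 1,
          (∫⁻ z, (‖gradient f z‖₊ : ENNReal) ^ 2
              ∂(π.map (fun p => (1 - s) • p.1 + s • p.2))) ^ (1 / 2 : ℝ) := by
  obtain ⟨hprob, rfl, rfl⟩ := hπ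
  have hgrad : Continuous (gradient f) := hf.continuous_gradient
  have hi0 : Integrable (fun p : E D × E D => f p.1) π := hf0.comp_measurable measurable_fst
  have hi1 : Integrable (fun p : E D × E D => f p.2) π := hf1.comp_measurable measurable_snd
  rw [integral_map measurable_fst.aemeasurable hf.continuous.aestronglyMeasurable,
    integral_map measurable_snd.aemeasurable hf.continuous.aestronglyMeasurable,
    ← integral_sub hi0 hi1, ← Real.enorm_eq_ofReal_abs,
    ← lintegral_const_mul' _ _ (ENNReal.rpow_ne_top_of_nonneg (by norm_num) hfin.ne)]
  calc ‖∫ p, f p.1 - f p.2 ∂π‖ₑ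
      ≤ ∫⁻ p, ‖f p.1 - f p.2‖ₑ ∂π := enorm_integral_le_lintegral_enorm _
    _ ≤ ∫⁻ p, (∫⁻ s in Set.Icc (0 : ℝ) 1,
          ‖p.1 - p.2‖ₑ * ‖gradient f ((1 - s) • p.1 + s • p.2)‖ₑ) ∂π :=
        lintegral_mono fun p => enorm_sub_le_lintegral_gradient hf p.1 p.2
    _ = ∫⁻ s in Set.Icc (0 : ℝ) 1, ∫⁻ p,
          ‖p.1 - p.2‖ₑ * ‖gradient f ((1 - s) • p.1 + s • p.2)‖ₑ ∂π := by
        refine lintegral_lintegral_swap (Measurable.aemeasurable ?_)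
        have hg : Measurable fun q : (E D × E D) × ℝ =>
            gradient f ((1 - q.2) • q.1.1 + q.2 • q.1.2) :=
          (hgrad.comp (by fun_prop)).measurable
        exact Measurable.mul (by fun_prop) hg.enorm
    _ ≤ _ := by
        refine lintegral_mono fun s => ?_
        have hmap : Measurable fun p : E D × E D => (1 - s) • p.1 + s • p.2 := by fun_prop
        rw [lintegral_map (hgrad.measurable.nnnorm.coe_nnreal_ennreal.pow_const 2) hmap]
        have hholder := ENNReal.lintegral_mul_le_Lp_mul_Lq π Real.HolderConjugate.two_two
          (f := fun p : E D × E D => ‖p.1 - p.2‖ₑ)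
          (g := fun p : E D × E D => ‖gradient f ((1 - s) • p.1 + s • p.2)‖ₑ)
          (by fun_prop) (hgrad.measurable.comp hmap).enorm.aemeasurable
        simpa only [Pi.mul_apply, ENNReal.rpow_two, enorm_eq_nnnorm] using hholder
end
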